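/- arXiv:2602.18183 — 2 statements merged into one kernel-verified Lean document; each statement's English description precedes it below -/
import Mathlib

section
/- Let p ∈ [1,∞) and ε > 0. For every u ∈ C_c²(ℝⁿ) and every x ∈ ℝⁿ, the function y ↦ J_ε(x−y)(u(x) − u(y) − ∇u(x)·(x−y)) belongs to L¹(ℝⁿ), so L_ε u(x) := ∫_{ℝⁿ} J_ε(x−y)(u(x) − u(y) − ∇u(x)·(x−y)) dy is well defined; moreover L_ε u ∈ L^p(ℝⁿ) and there is a constant C_* > 0, depending only on ρ and p (in particular independent of ε and u), such that ‖L_ε u‖_{L^p(ℝⁿ)} ≤ C_* ‖u‖_{W^{2,p}(ℝⁿ)}. -/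
open MeasureTheory Filter Topology ENNReal

noncomputable section

abbrev EV (n : ℕ) := EuclideanSpace ℝ (Fin n)

/-- The kernel `J(x) = ρ(x)/|x|²`. -/
def kernelJ {n : ℕ} (ρ : EV n → ℝ) (x : EV n) : ℝ := ρ x / ‖x‖ ^ 2

/-- The rescaled density `ρ_ε(x) = ε^{-n} ρ(x/ε)`. -/
def scaled {n : ℕ} (ρ : EV n → ℝ) (ε : ℝ) (x : EV n) : ℝ := (ε ^ n)⁻¹ * ρ (ε⁻¹ • x)

/-- Assumption (A1): `ρ` is measurable, nonnegative, not a.e. zero, even,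
and `∫ ρ(x)(1+|x|) dx < ∞`. -/
def A1 {n : ℕ} (ρ : EV n → ℝ) : Prop :=
  Measurable ρ ∧ (∀ x, 0 ≤ ρ x) ∧ ¬ (ρ =ᵐ[volume] (fun _ => (0 : ℝ))) ∧
  (∀ᵐ x : EV n ∂volume, ρ (-x) = ρ x) ∧
  Integrable (fun x : EV n => ρ x * (1 + ‖x‖)) volume

/-- `L_ε u (x) = ∫_{ℝⁿ} J_ε(x-y) (u(x) - u(y) - ∇u(x)·(x-y)) dy`. -/
def nlOp {n : ℕ} (ρ : EV n → ℝ) (ε : ℝ) (u : EV n → ℝ) (x : EV n) : ℝ :=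
  ∫ y : EV n, kernelJ (scaled ρ ε) (x - y) * (u x - u y - fderiv ℝ u x (x - y))

/-- The classical partial derivative `∂ᵢ u`. -/
def partialD {n : ℕ} (i : Fin n) (u : EV n → ℝ) : EV n → ℝ :=
  fun x => fderiv ℝ u x (EuclideanSpace.single i 1)

/-- Iterated classical partial derivatives along a list of directions. -/
def partialDList {n : ℕ} : List (Fin n) → (EV n → ℝ) → (EV n → ℝ)
  | [], u => u
  | i :: l, u => partialD i (partialDList l u)

/-- The `W^{k,p}`-norm of a (classically differentiable) function: the sum of the `L^p`
norms of all its partial derivatives of order at most `k`. -/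
def cWNorm {n : ℕ} (k : ℕ) (p : ℝ≥0∞) (μ : Measure (EV n)) (u : EV n → ℝ) : ℝ≥0∞ :=
  ∑' l : List (Fin n), if l.length ≤ k then eLpNorm (partialDList l u) p μ else 0

/-- Sum of absolute values of all second partial derivatives. -/
def hessSum {n : ℕ} (u : EV n → ℝ) (w : EV n) : ℝ :=
  ∑ q : Fin n × Fin n, |partialDList [q.1, q.2] u w|

lemma partial2_eq {n : ℕ} {u : EV n → ℝ} (hu : ContDiff ℝ 2 u) (i j : Fin n) (w : EV n) :
    partialDList [i, j] u w =
      fderiv ℝ (fderiv ℝ u) w (EuclideanSpace.single i 1) (EuclideanSpace.single j 1) := by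
  have hd : Differentiable ℝ (fderiv ℝ u) :=
    (hu.fderiv_right (m := 1) (by norm_num)).differentiable (by norm_num)
  simp only [partialDList]
  unfold partialD
  rw [fderiv_clm_apply (hd w) (differentiableAt_const _)]
  simp

lemma partial2_cont {n : ℕ} {u : EV n → ℝ} (hu : ContDiff ℝ 2 u) (i j : Fin n) :
    Continuous (partialDList [i, j] u) := by
  have hc : Continuous (fderiv ℝ (fderiv ℝ u)) :=
    (hu.fderiv_right (m := 1) (by norm_num)).continuous_fderiv (by norm_num)
  have : partialDList [i, j] u = fun w => fderiv ℝ (fderiv ℝ u) w (EuclideanSpace.single i 1)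
      (EuclideanSpace.single j 1) := funext fun w => partial2_eq hu i j w
  rw [this]
  exact (hc.clm_apply continuous_const).clm_apply continuous_const

lemma partial2_supp {n : ℕ} {u : EV n → ℝ} (hu : ContDiff ℝ 2 u) (hs : HasCompactSupport u)
    (i j : Fin n) : HasCompactSupport (partialDList [i, j] u) := by
  have hc : HasCompactSupport (fderiv ℝ (fderiv ℝ u)) := (hs.fderiv ℝ).fderiv ℝ
  have : partialDList [i, j] u = (fun A : EV n →L[ℝ] EV n →L[ℝ] ℝ =>
      A (EuclideanSpace.single i 1) (EuclideanSpace.single j 1)) ∘ fderiv ℝ (fderiv ℝ u) :=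
    funext fun w => partial2_eq hu i j w
  rw [this]
  exact hc.comp_left (by simp)

lemma hessSum_nonneg {n : ℕ} (u : EV n → ℝ) (w : EV n) : 0 ≤ hessSum u w :=
  Finset.sum_nonneg fun _ _ => abs_nonneg _

lemma hessSum_cont {n : ℕ} {u : EV n → ℝ} (hu : ContDiff ℝ 2 u) : Continuous (hessSum u) := by
  unfold hessSum
  exact continuous_finsetSum _ fun q _ => (partial2_cont hu q.1 q.2).abs

lemma hessSum_bound {n : ℕ} {u : EV n → ℝ} (hu : ContDiff ℝ 2 u) (hs : HasCompactSupport u) :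
    ∃ B : ℝ, ∀ w, hessSum u w ≤ B := by
  choose B hB using fun q : Fin n × Fin n =>
    (partial2_supp hu hs q.1 q.2).exists_bound_of_continuous (partial2_cont hu q.1 q.2)
  exact ⟨∑ q, B q, fun w => Finset.sum_le_sum fun q _ => by simpa using hB q w⟩

lemma hess_apply_le {n : ℕ} {u : EV n → ℝ} (hu : ContDiff ℝ 2 u) (w z : EV n) :
    |fderiv ℝ (fderiv ℝ u) w z z| ≤ ‖z‖ ^ 2 * hessSum u w := by
  have hz : z = ∑ i, z i • EuclideanSpace.single i (1 : ℝ) := by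
    ext k
    simp [Finset.sum_apply, Pi.single_apply]
  have key : fderiv ℝ (fderiv ℝ u) w z z =
      ∑ q : Fin n × Fin n, z q.1 * z q.2 * partialDList [q.1, q.2] u w := by
    rw [Fintype.sum_prod_type]
    conv_lhs => rw [hz]
    simp only [partial2_eq hu, map_sum, map_smul, ContinuousLinearMap.sum_apply,
      ContinuousLinearMap.smul_apply, smul_eq_mul, Finset.mul_sum]
    first
      | done
      | (rw [Finset.sum_comm]
         refine Finset.sum_congr rfl fun i _ => Finset.sum_congr rfl fun j _ => ?_
         ring)
  rw [key, hessSum, Finset.mul_sum]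
  refine (Finset.abs_sum_le_sum_abs _ _).trans (Finset.sum_le_sum fun q _ => ?_)
  rw [abs_mul, abs_mul, sq]
  have h1 : |z q.1| ≤ ‖z‖ := PiLp.norm_apply_le z q.1
  have h2 : |z q.2| ≤ ‖z‖ := PiLp.norm_apply_le z q.2
  gcongr

lemma taylor_enorm {n : ℕ} {u : EV n → ℝ} (hu : ContDiff ℝ 2 u) (x z : EV n) :
    ‖u x - u (x - z) - fderiv ℝ u x z‖ₑ ≤
      ENNReal.ofReal (‖z‖ ^ 2) *
        ∫⁻ t in Set.Ioc (0 : ℝ) 1, ENNReal.ofReal (hessSum u (x - t • z)) := by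
  have hu1 : Differentiable ℝ u := hu.differentiable (by norm_num)
  have hd : Differentiable ℝ (fderiv ℝ u) :=
    (hu.fderiv_right (m := 1) (by norm_num)).differentiable (by norm_num)
  have hc : Continuous (fderiv ℝ (fderiv ℝ u)) :=
    (hu.fderiv_right (m := 1) (by norm_num)).continuous_fderiv (by norm_num)
  have hl : ∀ t : ℝ, HasDerivAt (fun t : ℝ => x - t • z) (-z) t := fun t => by
    simpa using ((hasDerivAt_id t).smul_const z).const_sub x
  have hF : ∀ t : ℝ, HasDerivAt
      (fun t : ℝ => u (x - t • z) - (1 - t) * fderiv ℝ u (x - t • z) z)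
      ((1 - t) * fderiv ℝ (fderiv ℝ u) (x - t • z) z z) t := fun t => by
    have h1 := (hu1 (x - t • z)).hasFDerivAt.comp_hasDerivAt t (hl t)
    have h2 := (hd (x - t • z)).hasFDerivAt.comp_hasDerivAt t (hl t)
    have h3 := h2.clm_apply (hasDerivAt_const t z)
    have h4 := h1.sub (((hasDerivAt_id t).const_sub 1).mul h3)
    refine h4.congr_deriv ?_
    simp
  have hcont : Continuous fun t : ℝ => (1 - t) * fderiv ℝ (fderiv ℝ u) (x - t • z) z z := by
    have : Continuous fun t : ℝ => fderiv ℝ (fderiv ℝ u) (x - t • z) :=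
      hc.comp (by fun_prop)
    exact (by fun_prop : Continuous fun t : ℝ => 1 - t).mul
      ((this.clm_apply continuous_const).clm_apply continuous_const)
  have hint := intervalIntegral.integral_eq_sub_of_hasDerivAt (a := 0) (b := 1)
    (fun t _ => hF t) (hcont.intervalIntegrable _ _)
  have heq : u x - u (x - z) - fderiv ℝ u x z =
      -∫ t in (0:ℝ)..1, (1 - t) * fderiv ℝ (fderiv ℝ u) (x - t • z) z z := by
    rw [hint]; simp; ring
  rw [heq, enorm_neg, intervalIntegral.integral_of_le zero_le_one,
    ← lintegral_const_mul' _ _ ENNReal.ofReal_ne_top]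
  refine (enorm_integral_le_lintegral_enorm _).trans ?_
  refine setLIntegral_mono' measurableSet_Ioc fun t ht => ?_
  rw [← ENNReal.ofReal_mul (by positivity), Real.enorm_eq_ofReal_abs]
  refine ENNReal.ofReal_le_ofReal ?_
  rw [abs_mul]
  have h1 : |1 - t| ≤ 1 := by rw [abs_le]; constructor <;> linarith [ht.1, ht.2]
  calc |1 - t| * |fderiv ℝ (fderiv ℝ u) (x - t • z) z z|
      ≤ 1 * |fderiv ℝ (fderiv ℝ u) (x - t • z) z z| := by gcongr
    _ ≤ _ := by rw [one_mul]; exact hess_apply_le hu _ _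

lemma rho_integrable {n : ℕ} {ρ : EV n → ℝ} (hρ : A1 ρ) : Integrable ρ volume := by
  obtain ⟨hm, h0, -, -, hi⟩ := hρ
  refine hi.mono' hm.aestronglyMeasurable (ae_of_all _ fun x => ?_)
  rw [Real.norm_of_nonneg (h0 x)]
  nlinarith [h0 x, norm_nonneg x]

lemma scaled_meas {n : ℕ} {ρ : EV n → ℝ} (hρ : A1 ρ) (ε : ℝ) : Measurable (scaled ρ ε) := by
  unfold scaled
  exact (hρ.1.comp (measurable_const_smul _)).const_mul _

lemma scaled_nonneg {n : ℕ} {ρ : EV n → ℝ} (hρ : A1 ρ) {ε : ℝ} (hε : 0 < ε) (x : EV n) :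
    0 ≤ scaled ρ ε x := by
  unfold scaled
  exact mul_nonneg (by positivity) (hρ.2.1 _)

lemma scaled_lintegral {n : ℕ} {ρ : EV n → ℝ} (hρ : A1 ρ) {ε : ℝ} (hε : 0 < ε) :
    ∫⁻ z, ENNReal.ofReal (scaled ρ ε z) = ENNReal.ofReal (∫ x, ρ x) := by
  have hi := rho_integrable hρ
  have hi2 : Integrable (scaled ρ ε) volume := by
    unfold scaled
    exact (hi.comp_smul (inv_ne_zero hε.ne')).const_mul _
  rw [← ofReal_integral_eq_lintegral_ofReal hi2 (ae_of_all _ (scaled_nonneg hρ hε))]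
  congr 1
  unfold scaled
  rw [integral_const_mul, Measure.integral_comp_inv_smul_of_nonneg _ _ hε.le]
  simp only [finrank_euclideanSpace, Fintype.card_fin, smul_eq_mul]
  field_simp

/-- The majorant of the operator. -/
def majorant {n : ℕ} (ρ : EV n → ℝ) (ε : ℝ) (u : EV n → ℝ) (x : EV n) : ℝ≥0∞ :=
  ∫⁻ z, ENNReal.ofReal (scaled ρ ε z) *
    ∫⁻ t in Set.Ioc (0 : ℝ) 1, ENNReal.ofReal (hessSum u (x - t • z))

lemma integrand_le {n : ℕ} {ρ : EV n → ℝ} (hρ : A1 ρ) {ε : ℝ} (hε : 0 < ε) {u : EV n → ℝ}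
    (hu : ContDiff ℝ 2 u) (x : EV n) :
    ∫⁻ y, ‖kernelJ (scaled ρ ε) (x - y) * (u x - u y - fderiv ℝ u x (x - y))‖ₑ
      ≤ majorant ρ ε u x := by
  have := lintegral_sub_left_eq_self (μ := (volume : Measure (EV n))) (fun z =>
    ‖kernelJ (scaled ρ ε) z * (u x - u (x - z) - fderiv ℝ u x z)‖ₑ) x
  simp only [_root_.sub_sub_cancel] at this
  rw [this]
  refine lintegral_mono fun z => ?_
  rw [enorm_mul]
  refine (mul_le_mul_right (taylor_enorm hu x z) _).trans ?_
  rw [← mul_assoc]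
  gcongr
  unfold kernelJ
  rw [Real.enorm_of_nonneg (div_nonneg (scaled_nonneg hρ hε z) (by positivity)),
    ← ENNReal.ofReal_mul (div_nonneg (scaled_nonneg hρ hε z) (by positivity))]
  refine ENNReal.ofReal_le_ofReal ?_
  rcases eq_or_ne (‖z‖ ^ 2) 0 with h | h
  · rw [h, mul_zero]; exact scaled_nonneg hρ hε z
  · rw [div_mul_cancel₀ _ h]

lemma integrand_meas {n : ℕ} {ρ : EV n → ℝ} (hρ : A1 ρ) (ε : ℝ) {u : EV n → ℝ}
    (hu : ContDiff ℝ 2 u) :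
    Measurable (fun q : EV n × EV n => kernelJ (scaled ρ ε) (q.1 - q.2) *
      (u q.1 - u q.2 - fderiv ℝ u q.1 (q.1 - q.2))) := by
  have h1 : Measurable (kernelJ (scaled ρ ε)) := by
    unfold kernelJ
    exact (scaled_meas hρ ε).div (by fun_prop)
  have hc : Continuous (fderiv ℝ u) := hu.continuous_fderiv (by norm_num)
  have hcu : Continuous u := hu.continuous
  have h2 : Continuous fun q : EV n × EV n => u q.1 - u q.2 - fderiv ℝ u q.1 (q.1 - q.2) := by
    have : Continuous fun q : EV n × EV n => fderiv ℝ u q.1 (q.1 - q.2) :=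
      (hc.comp continuous_fst).clm_apply (by fun_prop)
    fun_prop
  exact (h1.comp (by fun_prop)).mul h2.measurable

lemma jensen_rpow {α : Type*} [MeasurableSpace α] (μ : Measure α) {f : α → ℝ≥0∞}
    (hf : Measurable f) {p : ℝ} (hp : 1 ≤ p) :
    (∫⁻ a, f a ∂μ) ^ p ≤ μ Set.univ ^ (p - 1) * ∫⁻ a, f a ^ p ∂μ := by
  have hp0 : 0 < p := by linarith
  have h := eLpNorm'_le_eLpNorm'_mul_rpow_measure_univ (μ := μ) (f := f) one_pos hp
    hf.aestronglyMeasurable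
  simp only [eLpNorm', enorm_eq_self, ENNReal.rpow_one, div_one] at h
  have h2 := ENNReal.rpow_le_rpow h hp0.le
  rw [ENNReal.mul_rpow_of_nonneg _ _ hp0.le, ← ENNReal.rpow_mul, ← ENNReal.rpow_mul,
    one_div_mul_cancel hp0.ne', ENNReal.rpow_one, sub_mul, one_div_mul_cancel hp0.ne',
    one_mul, mul_comm] at h2
  exact h2

lemma majorant_lp {n : ℕ} {ρ : EV n → ℝ} (hρ : A1 ρ) {ε : ℝ} (hε : 0 < ε) {u : EV n → ℝ}
    (hu : ContDiff ℝ 2 u) {p : ℝ} (hp : 1 ≤ p) :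
    ∫⁻ x, majorant ρ ε u x ^ p ≤
      ENNReal.ofReal (∫ x, ρ x) ^ p * ∫⁻ x, ENNReal.ofReal (hessSum u x) ^ p := by
  set M := ENNReal.ofReal (∫ x, ρ x) with hM
  have hsm : Measurable fun z => ENNReal.ofReal (scaled ρ ε z) := (scaled_meas hρ ε).ennreal_ofReal
  set ν : Measure (EV n) := volume.withDensity fun z => ENNReal.ofReal (scaled ρ ε z) with hν
  have hνu : ν Set.univ = M := by
    rw [hν, withDensity_apply _ MeasurableSet.univ, Measure.restrict_univ, scaled_lintegral hρ hε]
  have : IsFiniteMeasure ν := ⟨by rw [hνu]; exact ENNReal.ofReal_lt_top⟩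
  set τ : Measure ℝ := volume.restrict (Set.Ioc (0 : ℝ) 1) with hτ
  have hτu : τ Set.univ = 1 := by simp [hτ]
  have : IsFiniteMeasure τ := ⟨by rw [hτu]; exact ENNReal.one_lt_top⟩
  set μ := ν.prod τ with hμ
  have hμu : μ Set.univ = M := by
    rw [hμ, ← Set.univ_prod_univ, Measure.prod_prod, hνu, hτu, mul_one]
  set H : EV n → ℝ≥0∞ := fun w => ENNReal.ofReal (hessSum u w) with hH
  have hHm : Measurable H := (hessSum_cont hu).measurable.ennreal_ofReal
  have hjm : Measurable fun r : EV n × (EV n × ℝ) => H (r.1 - r.2.2 • r.2.1) :=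
    hHm.comp (by fun_prop)
  have hfm : ∀ x, Measurable fun q : EV n × ℝ => H (x - q.2 • q.1) := fun x =>
    hHm.comp (by fun_prop)
  have hmaj : ∀ x, majorant ρ ε u x = ∫⁻ q, H (x - q.2 • q.1) ∂μ := fun x => by
    rw [hμ, lintegral_prod _ (hfm x).aemeasurable, hν,
      lintegral_withDensity_eq_lintegral_mul _ hsm (Measurable.lintegral_prod_right' (hfm x))]
    rfl
  calc ∫⁻ x, majorant ρ ε u x ^ p
      ≤ ∫⁻ x, M ^ (p - 1) * ∫⁻ q, H (x - q.2 • q.1) ^ p ∂μ := by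
        refine lintegral_mono fun x => ?_
        simp only [hmaj x]
        rw [← hμu]
        exact jensen_rpow μ (hfm x) hp
    _ = M ^ (p - 1) * ∫⁻ x, ∫⁻ q, H (x - q.2 • q.1) ^ p ∂μ :=
        lintegral_const_mul' _ _ (ENNReal.rpow_ne_top_of_nonneg (by linarith) ENNReal.ofReal_ne_top)
    _ = M ^ (p - 1) * ∫⁻ q, ∫⁻ x, H (x - q.2 • q.1) ^ p ∂volume ∂μ := by
        rw [lintegral_lintegral_swap (hjm.pow_const p).aemeasurable]
    _ = M ^ (p - 1) * ∫⁻ q, (∫⁻ x, H x ^ p) ∂μ := by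
        congr 1
        refine lintegral_congr fun q => ?_
        exact lintegral_sub_right_eq_self (fun x => H x ^ p) _
    _ = M ^ p * ∫⁻ x, H x ^ p := by
        rw [lintegral_const, hμu, mul_comm _ M, ← mul_assoc]
        congr 1
        conv_lhs => rw [← ENNReal.rpow_one M, ← ENNReal.rpow_mul, one_mul]
        rw [← ENNReal.rpow_add_of_nonneg _ _ (by linarith) zero_le_one]
        congr 1
        ring

lemma hessSum_eLpNorm_le {n : ℕ} {u : EV n → ℝ} (hu : ContDiff ℝ 2 u) {p : ℝ≥0∞} (hp : 1 ≤ p) :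
    eLpNorm (hessSum u) p volume ≤ cWNorm 2 p volume u := by
  have h1 : hessSum u = ∑ q : Fin n × Fin n, fun w => |partialDList [q.1, q.2] u w| := by
    ext w; simp [hessSum]
  rw [h1]
  refine (eLpNorm_sum_le (fun q _ =>
    (partial2_cont hu q.1 q.2).abs.aestronglyMeasurable) hp).trans ?_
  have hinj : Function.Injective fun q : Fin n × Fin n => [q.1, q.2] := by
    rintro ⟨a, b⟩ ⟨c, d⟩ h
    simpa using h
  have h2 := ENNReal.tsum_comp_le_tsum_of_injective hinj
    (fun l : List (Fin n) => if l.length ≤ 2 then eLpNorm (partialDList l u) p volume else 0)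
  refine le_trans ?_ h2
  rw [tsum_fintype]
  refine Finset.sum_le_sum fun q _ => ?_
  simp only [List.length_cons, List.length_nil]
  simp only [zero_add, Nat.reduceAdd, le_refl, if_true]
  exact (eLpNorm_norm (partialDList [q.1, q.2] u)).le

lemma hessSum_memLp {n : ℕ} {u : EV n → ℝ} (hu : ContDiff ℝ 2 u) (hs : HasCompactSupport u)
    (p : ℝ≥0∞) : MemLp (hessSum u) p volume := by
  unfold hessSum
  exact memLp_finsetSum _ fun q _ =>
    ((partial2_cont hu q.1 q.2).memLp_of_hasCompactSupport (partial2_supp hu hs q.1 q.2)).abs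

lemma majorant_lt_top {n : ℕ} {ρ : EV n → ℝ} (hρ : A1 ρ) {ε : ℝ} (hε : 0 < ε) {u : EV n → ℝ}
    (hu : ContDiff ℝ 2 u) (hs : HasCompactSupport u) (x : EV n) : majorant ρ ε u x < ⊤ := by
  obtain ⟨B, hB⟩ := hessSum_bound hu hs
  have : majorant ρ ε u x ≤ ∫⁻ z, ENNReal.ofReal (scaled ρ ε z) * ENNReal.ofReal B := by
    refine lintegral_mono fun z => ?_
    gcongr
    refine (lintegral_mono fun t => ENNReal.ofReal_le_ofReal (hB _)).trans ?_
    simp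
  refine this.trans_lt ?_
  rw [lintegral_mul_const' _ _ ENNReal.ofReal_ne_top, scaled_lintegral hρ hε]
  exact ENNReal.mul_lt_top ENNReal.ofReal_lt_top ENNReal.ofReal_lt_top

lemma nlOp_eLpNorm_le {n : ℕ} {ρ : EV n → ℝ} (hρ : A1 ρ) {ε : ℝ} (hε : 0 < ε) {u : EV n → ℝ}
    (hu : ContDiff ℝ 2 u) {p : ℝ≥0∞} (hp1 : 1 ≤ p) (hp : p ≠ ⊤) :
    eLpNorm (nlOp ρ ε u) p volume ≤
      ENNReal.ofReal (∫ x, ρ x) * eLpNorm (hessSum u) p volume := by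
  have hp0 : p ≠ 0 := (zero_lt_one.trans_le hp1).ne'
  have hpr : 1 ≤ p.toReal := by
    rw [← ENNReal.toReal_one]
    exact ENNReal.toReal_mono hp hp1
  have hpp : 0 < p.toReal := by linarith
  rw [eLpNorm_eq_eLpNorm' hp0 hp, eLpNorm_eq_eLpNorm' hp0 hp, eLpNorm', eLpNorm']
  have h1 : ∫⁻ x, ‖nlOp ρ ε u x‖ₑ ^ p.toReal ≤
      ENNReal.ofReal (∫ x, ρ x) ^ p.toReal * ∫⁻ x, ‖hessSum u x‖ₑ ^ p.toReal := by
    have h2 := majorant_lp hρ hε hu hpr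
    simp only [Real.enorm_of_nonneg (hessSum_nonneg u _)]
    refine le_trans (lintegral_mono fun x => ?_) h2
    exact ENNReal.rpow_le_rpow
      ((enorm_integral_le_lintegral_enorm _).trans (integrand_le hρ hε hu x)) hpp.le
  refine (ENNReal.rpow_le_rpow h1 (by positivity)).trans ?_
  rw [ENNReal.mul_rpow_of_nonneg _ _ (by positivity), ← ENNReal.rpow_mul,
    mul_one_div_cancel hpp.ne', ENNReal.rpow_one]

/-- well-definedness and boundedness of the nonlocal operator on `ℝⁿ`:
for `u ∈ C_c²(ℝⁿ)` and `x ∈ ℝⁿ` the integrand defining `L_ε u (x)` is in `L¹(ℝⁿ)`, so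
`L_ε u` is well defined; moreover `L_ε u ∈ L^p(ℝⁿ)` and there is `C_* > 0` depending only
on `ρ` and `p` (in particular independent of `ε` and `u`) with
`‖L_ε u‖_{L^p} ≤ C_* ‖u‖_{W^{2,p}}`. -/
theorem nlOp_well_defined_and_bounded (n : ℕ) (hn : 1 ≤ n) (ρ : EV n → ℝ) (hρ : A1 ρ)
    (p : ℝ≥0∞) (hp1 : 1 ≤ p) (hp : p ≠ ⊤) :
    (∀ ε : ℝ, 0 < ε → ∀ u : EV n → ℝ, ContDiff ℝ 2 u → HasCompactSupport u →
      ∀ x : EV n,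
        Integrable
          (fun y : EV n => kernelJ (scaled ρ ε) (x - y) * (u x - u y - fderiv ℝ u x (x - y)))
          volume) ∧
    (∃ C : ℝ, 0 < C ∧ ∀ ε : ℝ, 0 < ε → ∀ u : EV n → ℝ,
      ContDiff ℝ 2 u → HasCompactSupport u →
        MemLp (nlOp ρ ε u) p volume ∧
        eLpNorm (nlOp ρ ε u) p volume ≤ ENNReal.ofReal C * cWNorm 2 p volume u) := by
  refine ⟨fun ε hε u hu hs x => ⟨?_, ?_⟩, (∫ x, ρ x) + 1, ?_, fun ε hε u hu hs => ?_⟩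
  · exact ((integrand_meas hρ ε hu).comp (measurable_prodMk_left (x := x))).aestronglyMeasurable
  · exact (integrand_le hρ hε hu x).trans_lt (majorant_lt_top hρ hε hu hs x)
  · have : 0 ≤ ∫ x, ρ x := integral_nonneg hρ.2.1
    linarith
  · have hle := nlOp_eLpNorm_le hρ hε hu hp1 hp
    refine ⟨⟨?_, ?_⟩, ?_⟩
    · unfold nlOp
      exact ((integrand_meas hρ ε hu).stronglyMeasurable.integral_prod_right').aestronglyMeasurable
    · exact hle.trans_lt (ENNReal.mul_lt_top ENNReal.ofReal_lt_top (hessSum_memLp hu hs p).2)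
    · refine hle.trans (mul_le_mul' (ENNReal.ofReal_le_ofReal (by linarith)) ?_)
      exact hessSum_eLpNorm_le hu hp1
end
end

section
/- Let Ω ⊊ ℝⁿ be a (not necessarily bounded) open domain with boundary of class C², let p ∈ [1,∞) and ε > 0, and let u ∈ C_c²(Ω̄). Then for every x ∈ Ω the principal value L_ε^Ω u(x) := lim_{r→0⁺} ∫_{Ω∩{|x−y| ≥ r}} J_ε(x−y)(u(x) − u(y)) dy exists, and the resulting function L_ε^Ω u belongs to L^p_loc(Ω); the map u ↦ L_ε^Ω u is linear. -/
open MeasureTheory Filter Topology ENNReal Matrix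

noncomputable section

/-- The momentum matrix `M = (1/2)∫_{ℝⁿ} J(z) z ⊗ z dz`. -/
def momentum {n : ℕ} (ρ : EV n → ℝ) : Matrix (Fin n) (Fin n) ℝ :=
  Matrix.of fun i j => (1 / 2 : ℝ) * ∫ z : EV n, kernelJ ρ z * z i * z j

/-- Multiplication of a vector of `ℝⁿ` by a matrix. -/
def mulVecE {m : ℕ} (Q : Matrix (Fin m) (Fin m) ℝ) (x : EV m) : EV m :=
  (WithLp.equiv 2 (Fin m → ℝ)).symm (Q.mulVec ((WithLp.equiv 2 (Fin m → ℝ)) x))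

/-- The point `(z', zₙ) ∈ ℝⁿ` with first coordinates `z' ∈ ℝ^{n-1}` and last coordinate `zₙ`. -/
def snocE {n : ℕ} (z' : EV n) (t : ℝ) : EV (n + 1) :=
  (WithLp.equiv 2 (Fin (n + 1) → ℝ)).symm
    (Fin.snoc ((WithLp.equiv 2 (Fin n → ℝ)) z') t)

/-- `v = ∂ᵢ u` weakly on `Ω`. -/
def WeakDerivOn {n : ℕ} (Ω : Set (EV n)) (i : Fin n) (u v : EV n → ℝ) : Prop :=
  ∀ φ : EV n → ℝ, ContDiff ℝ (⊤ : ℕ∞) φ → HasCompactSupport φ → tsupport φ ⊆ Ω →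
    ∫ x in Ω, u x * partialD i φ x = - ∫ x in Ω, v x * φ x

/-- `D` is a system of weak partial derivatives of `u` on `Ω` up to order `k`,
all lying in `L^p(Ω)`; i.e. `D` witnesses that `u ∈ W^{k,p}(Ω)`. -/
def IsSobDerivs {n : ℕ} (Ω : Set (EV n)) (k : ℕ) (p : ℝ≥0∞) (u : EV n → ℝ)
    (D : List (Fin n) → EV n → ℝ) : Prop :=
  D [] = u ∧
  (∀ l : List (Fin n), l.length < k → ∀ i : Fin n, WeakDerivOn Ω i (D l) (D (i :: l))) ∧
  (∀ l : List (Fin n), l.length ≤ k → MemLp (D l) p (volume.restrict Ω))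

/-- `u ∈ W^{k,p}(Ω)`. -/
def MemW {n : ℕ} (Ω : Set (EV n)) (k : ℕ) (p : ℝ≥0∞) (u : EV n → ℝ) : Prop :=
  ∃ D, IsSobDerivs Ω k p u D

/-- The `W^{k,p}`-norm computed from a system `D` of weak derivatives:
the sum of the `L^p` norms of all weak derivatives of order at most `k`. -/
def WNormD {n : ℕ} (k : ℕ) (p : ℝ≥0∞) (μ : Measure (EV n))
    (D : List (Fin n) → EV n → ℝ) : ℝ≥0∞ :=
  ∑' l : List (Fin n), if l.length ≤ k then eLpNorm (D l) p μ else 0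

/-- The first `n` coordinates of a point of `ℝ^{n+1}`. -/
def firstCoords {n : ℕ} (x : EV (n + 1)) : EV n :=
  (WithLp.equiv 2 (Fin n → ℝ)).symm (fun i => x i.castSucc)

/-- The curved half space `ℝⁿ_γ = {x : xₙ > γ(x₁,…,x_{n-1})}`. -/
def halfSpace {n : ℕ} (γ : EV n → ℝ) : Set (EV (n + 1)) :=
  {x : EV (n + 1) | γ (firstCoords x) < x (Fin.last n)}

/-- `γ ∈ C^k_b`: `γ` is `k` times continuously differentiable with bounded derivatives. -/
def Ckb {n : ℕ} (k : ℕ) (γ : EV n → ℝ) : Prop :=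
  ContDiff ℝ k γ ∧ ∀ m : ℕ, m ≤ k → ∃ C : ℝ, ∀ x, ‖iteratedFDeriv ℝ m γ x‖ ≤ C

/-- Assumption (A2): `ρ ∈ C¹(ℝⁿ∖{0})` with singularity bounds
`|ρ(x)| ≤ c₀|x|^{2-α-n}(1+|x|)^{-N}`, `|∇ρ(x)| ≤ c₁|x|^{1-α-n}(1+|x|)^{-N}` for some
`c₀, c₁ > 0`, `α ∈ (0,2)`, `N > 3-α`; and, with `A := √M`, the kernel satisfies
`∫_{ℝ^{n-1}} J(AQ(z', zₙ)) z' dz' = 0` for all `zₙ ∈ ℝ` and `Q ∈ SO(n)`.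
(The ambient dimension is `n + 1`.) -/
def A2 {n : ℕ} (ρ : EV (n + 1) → ℝ) : Prop :=
  ContDiffOn ℝ 1 ρ {(0 : EV (n + 1))}ᶜ ∧
  (∃ c₀ c₁ α N : ℝ, 0 < c₀ ∧ 0 < c₁ ∧ 0 < α ∧ α < 2 ∧ 3 - α < N ∧
    ∀ x : EV (n + 1), x ≠ 0 →
      |ρ x| ≤ c₀ * ‖x‖ ^ ((2 : ℝ) - α - (n + 1 : ℝ)) * (1 + ‖x‖) ^ (-N) ∧
      ‖fderiv ℝ ρ x‖ ≤ c₁ * ‖x‖ ^ ((1 : ℝ) - α - (n + 1 : ℝ)) * (1 + ‖x‖) ^ (-N)) ∧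
  (∃ A : Matrix (Fin (n + 1)) (Fin (n + 1)) ℝ, A.PosDef ∧ A * A = momentum ρ ∧
    ∀ t : ℝ, ∀ Q : Matrix (Fin (n + 1)) (Fin (n + 1)) ℝ, Qᵀ * Q = 1 → Q.det = 1 →
      (∫ z' : EV n, kernelJ ρ (mulVecE (A * Q) (snocE z' t)) • z') = 0)

/-- The homogeneous conormal boundary condition `M∇u · n = 0` on `∂Ω`, formulated weakly:
for any system of weak derivatives of `u ∈ W^{2,p}(Ω)` and any test function
`φ ∈ C_c^∞(ℝⁿ)`, Green's formula holds on `Ω` with no boundary contribution. -/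
def NeumannBC {m : ℕ} (Ω : Set (EV m)) (Mm : Matrix (Fin m) (Fin m) ℝ) (p : ℝ≥0∞)
    (u : EV m → ℝ) : Prop :=
  ∀ D : List (Fin m) → EV m → ℝ, IsSobDerivs Ω 2 p u D →
    ∀ φ : EV m → ℝ, ContDiff ℝ (⊤ : ℕ∞) φ → HasCompactSupport φ →
      (∑ i : Fin m, ∑ j : Fin m, Mm i j * ∫ x in Ω, D [i, j] x * φ x)
        = - ∑ i : Fin m, ∑ j : Fin m, Mm i j * ∫ x in Ω, D [j] x * partialD i φ x

/-- `u ∈ W^{k,p}(Ω)` together with the boundary condition `M∇u · n = 0` on `∂Ω`. -/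
def MemWN {m : ℕ} (Ω : Set (EV m)) (Mm : Matrix (Fin m) (Fin m) ℝ) (k : ℕ) (p : ℝ≥0∞)
    (u : EV m → ℝ) : Prop :=
  MemW Ω k p u ∧ NeumannBC Ω Mm p u

/-- `l` is the principal value `P.V. ∫_Ω J_ε(x-y)(u(x)-u(y)) dy` at the point `x`. -/
def pvAt {m : ℕ} (Ω : Set (EV m)) (ρ : EV m → ℝ) (ε : ℝ) (u : EV m → ℝ) (x : EV m)
    (l : ℝ) : Prop :=
  Tendsto
    (fun r : ℝ =>
      ∫ y in Ω ∩ {y : EV m | r ≤ dist x y}, kernelJ (scaled ρ ε) (x - y) * (u x - u y))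
    (𝓝[>] 0) (𝓝 l)

/-- `L` is a bounded linear extension to `W^{2,p}_M(Ω)` (Sobolev functions with the
boundary condition `M∇u · n = 0`), with operator bound `C`, of the nonlocal operator
`P.V. ∫_Ω J_ε(·-y)(u(·)-u(y)) dy` defined on `C_c²(cl Ω) ∩ W^{2,p}_M(Ω)`. -/
def IsNLExtOn {m : ℕ} (Ω : Set (EV m)) (Mm : Matrix (Fin m) (Fin m) ℝ) (ρ : EV m → ℝ)
    (p : ℝ≥0∞) (ε C : ℝ) (L : (EV m → ℝ) → EV m → ℝ) : Prop :=
  (∀ u : EV m → ℝ, ContDiff ℝ 2 u → HasCompactSupport u → MemWN Ω Mm 2 p u →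
    ∀ᵐ x ∂(volume.restrict Ω), pvAt Ω ρ ε u x (L u x)) ∧
  (∀ u v : EV m → ℝ, MemWN Ω Mm 2 p u → MemWN Ω Mm 2 p v → ∀ a b : ℝ,
    L (fun x => a * u x + b * v x) =ᵐ[volume.restrict Ω] fun x => a * L u x + b * L v x) ∧
  (∀ u : EV m → ℝ, MemWN Ω Mm 2 p u → MemLp (L u) p (volume.restrict Ω)) ∧
  (∀ u D, MemWN Ω Mm 2 p u → IsSobDerivs Ω 2 p u D →
    eLpNorm (L u) p (volume.restrict Ω)
      ≤ ENNReal.ofReal C * WNormD 2 p (volume.restrict Ω) D)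

/-- `Ω ⊆ ℝ^{n+1}` is an open set whose boundary is locally, up to a rotation, the region
above the graph of a `C^k` function with bounded derivatives (a domain of class `C^k`). -/
def IsGraphDomain {n : ℕ} (k : ℕ) (Ω : Set (EV (n + 1))) : Prop :=
  IsOpen Ω ∧ ∀ z ∈ frontier Ω,
    ∃ (U : Set (EV (n + 1))) (Q : Matrix (Fin (n + 1)) (Fin (n + 1)) ℝ) (γ : EV n → ℝ),
      IsOpen U ∧ z ∈ U ∧ Qᵀ * Q = 1 ∧ Q.det = 1 ∧ Ckb k γ ∧
      Ω ∩ U = (mulVecE Q '' halfSpace γ) ∩ U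

lemma aux_taylor {m : ℕ} {u : EV m → ℝ} (hu : ContDiff ℝ 2 u) (hc : HasCompactSupport u) :
    ∃ C : ℝ, 0 ≤ C ∧ ∀ x y, |u x - u y - fderiv ℝ u x (x - y)| ≤ C * ‖x - y‖ ^ 2 := by
  obtain ⟨C, hC⟩ := ContDiff.lipschitzWith_of_hasCompactSupport (𝕂 := ℝ) (n := 1)
    (hc.fderiv ℝ) (hu.fderiv_right (m := 1) (by norm_num)) (by norm_num)
  refine ⟨C, C.2, fun x y => ?_⟩
  have hd : Differentiable ℝ u := hu.differentiable (by norm_num)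
  have h := Convex.norm_image_sub_le_of_norm_hasFDerivWithin_le' (𝕜 := ℝ) (f := u)
    (f' := fderiv ℝ u) (φ := fderiv ℝ u x) (C := C * ‖x - y‖)
    (s := Metric.closedBall x ‖x - y‖) (x := y) (y := x)
    (fun z _ => (hd z).hasFDerivAt.hasFDerivWithinAt)
    (fun z hz => by
      have h1 := hC.dist_le_mul z x
      rw [dist_eq_norm] at h1
      exact h1.trans (mul_le_mul_of_nonneg_left (Metric.mem_closedBall.1 hz) C.2))
    (convex_closedBall _ _)
    (by rw [Metric.mem_closedBall, dist_comm, dist_eq_norm])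
    (Metric.mem_closedBall_self (norm_nonneg _))
  rw [Real.norm_eq_abs] at h
  calc _ ≤ _ := h
    _ = _ := by ring

/-- The regularised integrand. -/
def auxG {m : ℕ} (q : EV m → ℝ) (u : EV m → ℝ) (δ : ℝ) (x y : EV m) : ℝ :=
  kernelJ q (x - y) * (u x - u y - if ‖x - y‖ < δ then fderiv ℝ u x (x - y) else 0)

lemma auxG_meas {m : ℕ} {q : EV m → ℝ} (hq : Measurable q) {u : EV m → ℝ}
    (hu : ContDiff ℝ 2 u) (δ : ℝ) :
    Measurable (fun z : EV m × EV m => auxG q u δ z.1 z.2) := by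
  unfold auxG kernelJ
  have h1 : Continuous u := hu.continuous
  have h2 : Continuous (fderiv ℝ u) := hu.continuous_fderiv (by norm_num)
  have h3 : Measurable (fun z : EV m × EV m => fderiv ℝ u z.1 (z.1 - z.2)) :=
    ((h2.comp continuous_fst).clm_apply (continuous_fst.sub continuous_snd)).measurable
  have h4 : Measurable (fun z : EV m × EV m => z.1 - z.2) := by fun_prop
  have h5 : MeasurableSet {z : EV m × EV m | ‖z.1 - z.2‖ < δ} :=
    measurableSet_lt h4.norm measurable_const
  have h6 : Measurable (fun z : EV m × EV m =>
      if ‖z.1 - z.2‖ < δ then fderiv ℝ u z.1 (z.1 - z.2) else 0) :=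
    Measurable.ite h5 h3 measurable_const
  have h7 : Measurable (fun z : EV m × EV m => u z.1) := h1.measurable.comp measurable_fst
  have h8 : Measurable (fun z : EV m × EV m => u z.2) := h1.measurable.comp measurable_snd
  exact ((hq.comp h4).div (h4.norm.pow_const 2)).mul ((h7.sub h8).sub h6)

lemma auxG_bound {m : ℕ} {q : EV m → ℝ} (hq : ∀ x, 0 ≤ q x) {u : EV m → ℝ}
    (hu : ContDiff ℝ 2 u) (hc : HasCompactSupport u) {δ : ℝ} (hδ : 0 < δ) :
    ∃ C : ℝ, ∀ x y, ‖auxG q u δ x y‖ ≤ C * q (x - y) := by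
  obtain ⟨C, hC0, hC⟩ := aux_taylor hu hc
  obtain ⟨M, hM⟩ := hc.exists_bound_of_continuous hu.continuous
  have hM0 : 0 ≤ M := (norm_nonneg _).trans (hM 0)
  refine ⟨C + 2 * M / δ ^ 2, fun x y => ?_⟩
  have key : |u x - u y - if ‖x - y‖ < δ then fderiv ℝ u x (x - y) else 0| ≤
      (C + 2 * M / δ ^ 2) * ‖x - y‖ ^ 2 := by
    split_ifs with h
    · refine (hC x y).trans ?_
      gcongr
      have : 0 ≤ 2 * M / δ ^ 2 := by positivity
      linarith
    · rw [sub_zero]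
      have h1 : |u x - u y| ≤ 2 * M := by
        have a := hM x
        have b := hM y
        rw [Real.norm_eq_abs] at a b
        rw [abs_le] at *
        constructor <;> linarith
      have h2 : 2 * M ≤ 2 * M / δ ^ 2 * ‖x - y‖ ^ 2 := by
        have : δ ^ 2 ≤ ‖x - y‖ ^ 2 := by
          gcongr
          exact not_lt.1 h
        rw [div_mul_eq_mul_div, le_div_iff₀ (by positivity)]
        gcongr
      nlinarith [mul_nonneg hC0 (sq_nonneg ‖x - y‖)]
  unfold auxG kernelJ
  rw [norm_mul, Real.norm_eq_abs, Real.norm_eq_abs, abs_div, abs_of_nonneg (hq _),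
    abs_of_nonneg (sq_nonneg _)]
  have hq' := hq (x - y)
  rcases eq_or_ne (‖x - y‖ ^ 2) 0 with h0 | h0
  · rw [h0, _root_.div_zero, zero_mul]
    positivity
  · calc _ ≤ q (x - y) / ‖x - y‖ ^ 2 * ((C + 2 * M / δ ^ 2) * ‖x - y‖ ^ 2) := by gcongr
      _ = _ := by
        have h1 : ‖x - y‖ ≠ 0 := fun h => h0 (by rw [h]; norm_num)
        field_simp

lemma auxG_int {m : ℕ} {q : EV m → ℝ} (hqm : Measurable q) (hq : ∀ x, 0 ≤ q x)
    (hqi : Integrable q volume) {u : EV m → ℝ}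
    (hu : ContDiff ℝ 2 u) (hc : HasCompactSupport u) {δ : ℝ} (hδ : 0 < δ) (x : EV m) :
    Integrable (auxG q u δ x) volume := by
  obtain ⟨C, hC⟩ := auxG_bound hq hu hc hδ
  refine Integrable.mono' ((hqi.comp_sub_left x).const_mul C) ?_ (ae_of_all _ (hC x))
  exact ((auxG_meas hqm hu δ).comp measurable_prodMk_left).aestronglyMeasurable

lemma aux_odd {m : ℕ} {q : EV m → ℝ} (hqe : ∀ᵐ x ∂(volume : Measure (EV m)), q (-x) = q x)
    (A : EV m →L[ℝ] ℝ) (r δ : ℝ) :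
    ∫ z : EV m, (if r ≤ ‖z‖ ∧ ‖z‖ < δ then kernelJ q z * A z else 0) = 0 := by
  set f : EV m → ℝ := fun z => if r ≤ ‖z‖ ∧ ‖z‖ < δ then kernelJ q z * A z else 0 with hf
  have h1 : ∫ z, f (-z) = ∫ z, f z := integral_neg_eq_self f volume
  have h2 : ∫ z, f (-z) = ∫ z, - f z := by
    refine integral_congr_ae ?_
    filter_upwards [hqe] with z hz
    simp only [hf, norm_neg, kernelJ, hz, map_neg]
    split_ifs <;> simp
  rw [integral_neg] at h2
  linarith

lemma aux_oddint {m : ℕ} {q : EV m → ℝ} (hqm : Measurable q) (hq : ∀ x, 0 ≤ q x)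
    (hqi : Integrable q volume)
    (A : EV m →L[ℝ] ℝ) {r : ℝ} (hr : 0 < r) (δ : ℝ) :
    Integrable (fun z : EV m => if r ≤ ‖z‖ ∧ ‖z‖ < δ then kernelJ q z * A z else 0) volume := by
  refine Integrable.mono' (hqi.const_mul (‖A‖ / r)) ?_ (ae_of_all _ fun z => ?_)
  · refine Measurable.aestronglyMeasurable (Measurable.ite ?_ ?_ measurable_const)
    · exact (measurableSet_le measurable_const measurable_norm).inter
        (measurableSet_lt measurable_norm measurable_const)
    · unfold kernelJ
      exact (hqm.div (measurable_norm.pow_const 2)).mul A.continuous.measurable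
  · have hq' := hq z
    split_ifs with h
    · unfold kernelJ
      have hz : 0 < ‖z‖ := hr.trans_le h.1
      rw [norm_mul, norm_div, Real.norm_of_nonneg hq', Real.norm_of_nonneg (sq_nonneg _)]
      calc q z / ‖z‖ ^ 2 * ‖A z‖ ≤ q z / ‖z‖ ^ 2 * (‖A‖ * ‖z‖) := by
            gcongr
            exact A.le_opNorm z
        _ = ‖A‖ / ‖z‖ * q z := by field_simp
        _ ≤ _ := by
          gcongr
          exact h.1
    · rw [norm_zero]
      positivity

lemma aux_trunc {m : ℕ} {q : EV m → ℝ} (hqm : Measurable q) (hq : ∀ x, 0 ≤ q x)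
    (hqi : Integrable q volume) (hqe : ∀ᵐ x ∂(volume : Measure (EV m)), q (-x) = q x)
    {u : EV m → ℝ} (hu : ContDiff ℝ 2 u) (hc : HasCompactSupport u) {δ : ℝ} (hδ : 0 < δ)
    {Ω : Set (EV m)} (hΩ : MeasurableSet Ω) {x : EV m} (hb : Metric.ball x δ ⊆ Ω)
    {r : ℝ} (hr : 0 < r) :
    ∫ y in Ω ∩ {y : EV m | r ≤ dist x y}, kernelJ q (x - y) * (u x - u y) =
      ∫ y in Ω, {y : EV m | r ≤ dist x y}.indicator (auxG q u δ x) y := by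
  have hS : MeasurableSet {y : EV m | r ≤ dist x y} :=
    measurableSet_le measurable_const (measurable_const.dist measurable_id)
  rw [setIntegral_indicator hS]
  set f : EV m → ℝ := fun z =>
    if r ≤ ‖z‖ ∧ ‖z‖ < δ then kernelJ q z * fderiv ℝ u x z else 0 with hf
  have hfi : Integrable (fun y => f (x - y)) volume :=
    (aux_oddint hqm hq hqi (fderiv ℝ u x) hr δ).comp_sub_left x
  have hf0 : ∫ y in Ω ∩ {y : EV m | r ≤ dist x y}, f (x - y) = 0 := by
    rw [setIntegral_eq_integral_of_forall_compl_eq_zero]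
    · rw [integral_sub_left_eq_self f volume x]
      exact aux_odd hqe _ r δ
    · intro y hy
      simp only [hf]
      rw [if_neg]
      rintro ⟨h1, h2⟩
      refine hy ⟨hb ?_, ?_⟩
      · rwa [Metric.mem_ball, dist_comm, dist_eq_norm]
      · rwa [Set.mem_setOf_eq, dist_eq_norm]
  have e : ∫ y in Ω ∩ {y : EV m | r ≤ dist x y}, kernelJ q (x - y) * (u x - u y) =
      ∫ y in Ω ∩ {y : EV m | r ≤ dist x y}, (auxG q u δ x y + f (x - y)) := by
    refine setIntegral_congr_fun (hΩ.inter hS) ?_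
    rintro y ⟨_, hy⟩
    rw [Set.mem_setOf_eq, dist_eq_norm] at hy
    simp only [hf, auxG, hy, true_and]
    split_ifs <;> ring
  rw [e, integral_add (auxG_int hqm hq hqi hu hc hδ x).integrableOn hfi.integrableOn, hf0,
    add_zero]

lemma aux_tendsto {m : ℕ} {q : EV m → ℝ} (hqm : Measurable q) (hq : ∀ x, 0 ≤ q x)
    (hqi : Integrable q volume) (hqe : ∀ᵐ x ∂(volume : Measure (EV m)), q (-x) = q x)
    {u : EV m → ℝ} (hu : ContDiff ℝ 2 u) (hc : HasCompactSupport u) {δ : ℝ} (hδ : 0 < δ)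
    {Ω : Set (EV m)} (hΩ : MeasurableSet Ω) {x : EV m} (hb : Metric.ball x δ ⊆ Ω) :
    Tendsto (fun r : ℝ =>
      ∫ y in Ω ∩ {y : EV m | r ≤ dist x y}, kernelJ q (x - y) * (u x - u y))
      (𝓝[>] 0) (𝓝 (∫ y in Ω, auxG q u δ x y)) := by
  have hS (r : ℝ) : MeasurableSet {y : EV m | r ≤ dist x y} :=
    measurableSet_le measurable_const (measurable_const.dist measurable_id)
  have hG := auxG_int hqm hq hqi hu hc hδ x
  have h : Tendsto (fun r : ℝ =>
      ∫ y in Ω, {y : EV m | r ≤ dist x y}.indicator (auxG q u δ x) y)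
      (𝓝[>] 0) (𝓝 (∫ y in Ω, auxG q u δ x y)) := by
    refine tendsto_integral_filter_of_dominated_convergence (fun y => ‖auxG q u δ x y‖)
      (Eventually.of_forall fun r => (hG.indicator (hS r)).aestronglyMeasurable.restrict)
      (Eventually.of_forall fun r => ae_of_all _ fun y => norm_indicator_le_norm_self _ _)
      hG.norm.integrableOn (ae_of_all _ fun y => ?_)
    rcases eq_or_ne x y with rfl | hxy
    · have h0 : auxG q u δ x x = 0 := by simp [auxG]
      rw [h0]
      refine tendsto_const_nhds.congr fun r => ?_
      simp only [Set.indicator]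
      split_ifs <;> simp [h0]
    · refine tendsto_const_nhds.congr' ?_
      filter_upwards [Ioo_mem_nhdsGT (dist_pos.2 hxy)] with r hr
      rw [Set.indicator_of_mem]
      exact hr.2.le
  refine h.congr' ?_
  filter_upwards [self_mem_nhdsWithin] with r hr
  exact (aux_trunc hqm hq hqi hqe hu hc hδ hΩ hb hr).symm

/-- well-definedness on a `C²` domain: if `Ω ⊊ ℝⁿ` is a domain with
boundary of class `C²`, then for every `u ∈ C_c²(Ω̄)` (modelled as the restriction to `Ω`
of a `C²` function with compact support) and every `x ∈ Ω` the principal value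
`L_ε^Ω u (x) = lim_{r→0⁺} ∫_{Ω ∩ {|x-y| ≥ r}} J_ε(x-y)(u(x)-u(y)) dy` exists, the
resulting function `L_ε^Ω u` belongs to `L^p_loc(Ω)`, and `u ↦ L_ε^Ω u` is linear. -/
theorem pv_well_defined_on_C2_domain (n : ℕ) (Ω : Set (EV (n + 1)))
    (hΩ : IsGraphDomain 2 Ω) (hconn : IsConnected Ω) (hproper : Ω ≠ Set.univ)
    (ρ : EV (n + 1) → ℝ) (hρ : A1 ρ)
    (p : ℝ≥0∞) (hp1 : 1 ≤ p) (hp : p ≠ ⊤) (ε : ℝ) (hε : 0 < ε) :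
    ∃ L : (EV (n + 1) → ℝ) → EV (n + 1) → ℝ,
      (∀ u : EV (n + 1) → ℝ, ContDiff ℝ 2 u → HasCompactSupport u →
        ∀ x ∈ Ω, pvAt Ω ρ ε u x (L u x)) ∧
      (∀ u : EV (n + 1) → ℝ, ContDiff ℝ 2 u → HasCompactSupport u →
        ∀ K : Set (EV (n + 1)), K ⊆ Ω → IsCompact K →
          MemLp (L u) p (volume.restrict K)) ∧
      (∀ u v : EV (n + 1) → ℝ, ContDiff ℝ 2 u → HasCompactSupport u →
        ContDiff ℝ 2 v → HasCompactSupport v → ∀ a b : ℝ, ∀ x ∈ Ω,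
          L (fun y => a * u y + b * v y) x = a * L u x + b * L v x) := by
  classical
  obtain ⟨hm, h0, -, he, hi⟩ := hρ
  set q := scaled ρ ε with hqdef
  have hqm : Measurable q := (hm.comp (measurable_const_smul ε⁻¹)).const_mul _
  have hq0 : ∀ x, 0 ≤ q x := fun x => mul_nonneg (by positivity) (h0 _)
  have hρi : Integrable ρ volume := by
    refine hi.mono' hm.aestronglyMeasurable (ae_of_all _ fun x => ?_)
    rw [Real.norm_of_nonneg (h0 x)]
    nlinarith [h0 x, norm_nonneg x, mul_nonneg (h0 x) (norm_nonneg x)]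
  have hqi : Integrable q volume :=
    (hρi.comp_smul (inv_ne_zero hε.ne')).const_mul _
  have hqe : ∀ᵐ x ∂(volume : Measure (EV (n + 1))), q (-x) = q x := by
    have hs : Measure.QuasiMeasurePreserving (fun x : EV (n + 1) => ε⁻¹ • x) volume volume := by
      refine ⟨measurable_const_smul _, ?_⟩
      rw [Measure.map_addHaar_smul _ (inv_ne_zero hε.ne')]
      exact Measure.smul_absolutelyContinuous
    filter_upwards [hs.ae he] with x hx
    simp only [hqdef, scaled, smul_neg, hx]
  have hΩo := hΩ.1
  have hΩm := hΩo.measurableSet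
  let L : (EV (n + 1) → ℝ) → EV (n + 1) → ℝ := fun u x =>
    limUnder (𝓝[>] (0 : ℝ)) (fun r : ℝ =>
      ∫ y in Ω ∩ {y : EV (n + 1) | r ≤ dist x y}, kernelJ q (x - y) * (u x - u y))
  have hL : ∀ u : EV (n + 1) → ℝ, ContDiff ℝ 2 u → HasCompactSupport u → ∀ δ : ℝ, 0 < δ →
      ∀ x, Metric.ball x δ ⊆ Ω → L u x = ∫ y in Ω, auxG q u δ x y :=
    fun u hu hc δ hδ x hb => (aux_tendsto hqm hq0 hqi hqe hu hc hδ hΩm hb).limUnder_eq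
  refine ⟨L, ?_, ?_, ?_⟩
  · intro u hu hc x hx
    obtain ⟨δ, hδ, hb⟩ := Metric.isOpen_iff.1 hΩo x hx
    rw [hL u hu hc δ hδ x hb]
    exact aux_tendsto hqm hq0 hqi hqe hu hc hδ hΩm hb
  · intro u hu hc K hK hKc
    obtain ⟨δ, hδ, hb⟩ := hKc.exists_thickening_subset_open hΩo hK
    have hb' : ∀ x ∈ K, Metric.ball x δ ⊆ Ω := fun x hx =>
      (Metric.ball_subset_thickening hx δ).trans hb
    have : IsFiniteMeasure (volume.restrict K) := ⟨by
      rw [Measure.restrict_apply_univ]; exact hKc.measure_lt_top⟩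
    obtain ⟨C, hC⟩ := auxG_bound hq0 hu hc hδ
    have hsm : StronglyMeasurable fun x => ∫ y in Ω, auxG q u δ x y :=
      (auxG_meas hqm hu δ).stronglyMeasurable.integral_prod_right'
    have hmem : MemLp (fun x => ∫ y in Ω, auxG q u δ x y) p (volume.restrict K) := by
      refine MemLp.of_bound hsm.aestronglyMeasurable (∫ y, C * q y) (ae_of_all _ fun x => ?_)
      have hG := auxG_int hqm hq0 hqi hu hc hδ x
      calc _ ≤ ∫ y in Ω, ‖auxG q u δ x y‖ := norm_integral_le_integral_norm _
        _ ≤ ∫ y, ‖auxG q u δ x y‖ :=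
          setIntegral_le_integral hG.norm (ae_of_all _ fun y => norm_nonneg _)
        _ ≤ ∫ y, C * q (x - y) :=
          integral_mono hG.norm ((hqi.comp_sub_left x).const_mul C) (hC x)
        _ = _ := integral_sub_left_eq_self (fun y => C * q y) volume x
    refine hmem.ae_eq ?_
    filter_upwards [ae_restrict_mem hKc.measurableSet] with x hx
    exact (hL u hu hc δ hδ x (hb' x hx)).symm
  · intro u v hu huc hv hvc a b x hx
    obtain ⟨δ, hδ, hbl⟩ := Metric.isOpen_iff.1 hΩo x hx
    have hw : ContDiff ℝ 2 (fun y => a * u y + b * v y) :=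
      (contDiff_const.mul hu).add (contDiff_const.mul hv)
    have hwc : HasCompactSupport (fun y => a * u y + b * v y) :=
      (huc.mul_left (f := fun _ => a)).add (hvc.mul_left (f := fun _ => b))
    rw [hL _ hw hwc δ hδ x hbl, hL u hu huc δ hδ x hbl, hL v hv hvc δ hδ x hbl,
      ← integral_const_mul, ← integral_const_mul, ← integral_add]
    · refine integral_congr_ae (ae_of_all _ fun y => ?_)
      have hud : DifferentiableAt ℝ u x := hu.differentiable (by norm_num) x
      have hvd : DifferentiableAt ℝ v x := hv.differentiable (by norm_num) x
      have hd : fderiv ℝ (fun y => a * u y + b * v y) x =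
          a • fderiv ℝ u x + b • fderiv ℝ v x :=
        ((hud.hasFDerivAt.const_mul a).add (hvd.hasFDerivAt.const_mul b)).fderiv
      simp only [auxG, hd, ContinuousLinearMap.add_apply, ContinuousLinearMap.smul_apply,
        smul_eq_mul]
      split_ifs <;> ring
    · exact ((auxG_int hqm hq0 hqi hu huc hδ x).const_mul a).integrableOn
    · exact ((auxG_int hqm hq0 hqi hv hvc hδ x).const_mul b).integrableOn
end
end
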